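/- Let V be an n-dimensional vector space over a finite field F_q and let G be a group acting linearly on V. Let a and b be two compositions of n of the same length r such that the partition obtained by sorting a dominates the partition obtained by sorting b. Then the number of G-orbits on the flag variety Fl_a(V) is at most the number of G-orbits on Fl_b(V). -/

import Mathlib

/-- `f` is a flag of type `(a 0, ..., a (r-1))` in `V`: a chain
`⊥ = V₀ ⊆ V₁ ⊆ ... ⊆ V_r = V` with `dim (V_i / V_{i-1}) = a i`. -/
def IsFlagOfType {F V : Type*} [Field F] [AddCommGroup V] [Module F V] {r : ℕ}
    (a : Fin r → ℕ) (f : Fin (r + 1) → Submodule F V) : Prop :=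
  Monotone f ∧ f 0 = ⊥ ∧ f (Fin.last r) = ⊤ ∧
    ∀ i : Fin r, Module.finrank F (f i.succ) = Module.finrank F (f i.castSucc) + a i

/-- The number of orbits of `G`, acting linearly on `V` through `ρ`, on the
flag variety of flags of type `a` in `V`, counted as the number of orbit sets. -/
noncomputable def flagOrbitCount (F V G : Type*) [Field F] [AddCommGroup V] [Module F V]
    [Group G] (ρ : G →* (V ≃ₗ[F] V)) {r : ℕ} (a : Fin r → ℕ) : ℕ :=
  Nat.card {s : Set {f : Fin (r + 1) → Submodule F V // IsFlagOfType a f} //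
    ∃ f₀ : {f : Fin (r + 1) → Submodule F V // IsFlagOfType a f},
      s = {f : {f : Fin (r + 1) → Submodule F V // IsFlagOfType a f} | ∃ g : G,
        (f : Fin (r + 1) → Submodule F V) =
          fun i => Submodule.map ((ρ g) : V →ₗ[F] V) (f₀.1 i)}}

/-- Sort a tuple of naturals into weakly decreasing order: the associated partition. -/
noncomputable def sortDesc {r : ℕ} (f : Fin r → ℕ) : Fin r → ℕ :=
  (f ∘ Tuple.sort f) ∘ Fin.rev

open Module

section kantor
variable {F V : Type*} [Field F] [AddCommGroup V] [Module F V]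

lemma glue_map {S Q : Submodule F V} (h : Disjoint S Q) (χ : V →ₗ[F] V) (ψ : Q →ₗ[F] V) :
    ∃ χ' : V →ₗ[F] V, (∀ x ∈ S, χ' x = χ x) ∧ ∀ x : Q, χ' x = ψ x := by
  obtain ⟨Q', hQ, hc⟩ := h.symm.exists_isCompl
  obtain ⟨ψ', hψ⟩ := LinearMap.exists_extend ψ
  refine ⟨LinearMap.ofIsCompl hc.symm (χ ∘ₗ S.subtype) (ψ' ∘ₗ Submodule.subtype _), ?_, ?_⟩
  · intro x hx
    exact LinearMap.ofIsCompl_apply_left hc.symm ⟨x, hx⟩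
  · intro x
    have := LinearMap.ofIsCompl_apply_right hc.symm (φ := χ ∘ₗ S.subtype)
      (ψ := ψ' ∘ₗ Submodule.subtype _) ⟨x, hQ x.2⟩
    rw [this]
    exact LinearMap.congr_fun hψ x

lemma map_eq_of_eqOn {S : Submodule F V} {g h : V →ₗ[F] V} (H : ∀ x ∈ S, g x = h x) :
    S.map g = S.map h := by
  ext y; simp only [Submodule.mem_map]
  constructor
  · rintro ⟨x, hx, rfl⟩; exact ⟨x, hx, (H x hx).symm⟩
  · rintro ⟨x, hx, rfl⟩; exact ⟨x, hx, (H x hx)⟩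

lemma map_of_equiv {Q R : Submodule F V} (e : Q ≃ₗ[F] R) {χ : V →ₗ[F] V}
    (h : ∀ x : Q, χ x = (R.subtype ∘ₗ e.toLinearMap) x) : Q.map χ = R := by
  ext y; simp only [Submodule.mem_map]
  constructor
  · rintro ⟨x, hx, rfl⟩
    rw [h ⟨x, hx⟩]; exact (e ⟨x, hx⟩).2
  · intro hy
    refine ⟨e.symm ⟨y, hy⟩, (e.symm ⟨y, hy⟩).2, ?_⟩
    rw [h]; simp

lemma trans_aux [FiniteDimensional F V] (B U₀ U U₂ : Submodule F V) 
    (h0B : U₀ ≤ B) (hUB : U ≤ B) (hU₂B : U₂ ≤ B) (hC : U ⊓ U₀ = U₂ ⊓ U₀)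
    (hd : finrank F U = finrank F U₂) :
    ∃ g : V ≃ₗ[F] V, (∀ x ∈ U₀, g x = x) ∧ U.map (g : V →ₗ[F] V) = U₂ ∧
      B.map (g : V →ₗ[F] V) = B := by
  have key : ∀ U : Submodule F V, U ≤ B → ∃ E R, Disjoint U₀ E ∧ Disjoint (U₀ ⊔ E) R ∧
      (U ⊓ U₀) ⊔ E = U ∧ U₀ ⊔ E ⊔ R = B ∧ finrank F (U ⊓ U₀ : Submodule F V) + finrank F E = finrank F U ∧
      finrank F U₀ + finrank F E + finrank F R = finrank F B := by
    intro U hU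
    obtain ⟨E, hE, hE'⟩ := IsModularLattice.exists_disjoint_and_sup_eq
      (inf_le_left : U ⊓ U₀ ≤ U)
    have hEU : E ≤ U := hE' ▸ le_sup_right
    have hd0 : Disjoint U₀ E := by
      rw [disjoint_iff] at hE ⊢
      rw [eq_bot_iff, ← hE]
      exact le_inf (le_inf (inf_le_right.trans hEU) inf_le_left) inf_le_right
    obtain ⟨R, hR, hR'⟩ := IsModularLattice.exists_disjoint_and_sup_eq
      (sup_le h0B (hEU.trans hU) : U₀ ⊔ E ≤ B)
    refine ⟨E, R, hd0, hR, hE', hR', ?_, ?_⟩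
    · have := Submodule.finrank_sup_add_finrank_inf_eq (U ⊓ U₀) E
      rw [hE', hE.eq_bot, finrank_bot] at this; omega
    · have t1 := Submodule.finrank_sup_add_finrank_inf_eq (U₀ ⊔ E) R
      have t2 := Submodule.finrank_sup_add_finrank_inf_eq U₀ E
      rw [hR', hR.eq_bot, finrank_bot] at t1
      rw [hd0.eq_bot, finrank_bot] at t2
      omega
  obtain ⟨E, R, h1, h2, h3, h4, h5, h6⟩ := key U hUB
  obtain ⟨E', R', h1', h2', h3', h4', h5', h6'⟩ := key U₂ hU₂B
  rw [hC] at h5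
  obtain ⟨Q, hQ⟩ := exists_isCompl B
  have eE : E ≃ₗ[F] E' := LinearEquiv.ofFinrankEq _ _ (by omega)
  have eR : R ≃ₗ[F] R' := LinearEquiv.ofFinrankEq _ _ (by omega)
  obtain ⟨χ₁, a1, b1⟩ := glue_map h1 LinearMap.id (E'.subtype ∘ₗ eE.toLinearMap)
  obtain ⟨χ₂, a2, b2⟩ := glue_map h2 χ₁ (R'.subtype ∘ₗ eR.toLinearMap)
  obtain ⟨χ, a3, b3⟩ := glue_map (S := B) hQ.disjoint χ₂ (Q.subtype)
  have hEB : E ≤ B := h4 ▸ le_sup_right.trans le_sup_left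
  have hRB : R ≤ B := h4 ▸ le_sup_right
  have fix0 : ∀ x ∈ U₀, χ x = x := fun x hx => by
    rw [a3 x (h0B hx), a2 x (le_sup_left (a := U₀) (b := E) hx), a1 x hx]; rfl
  have m0 : ∀ C ≤ U₀, C.map χ = C := fun C hC => by
    rw [map_eq_of_eqOn (h := LinearMap.id) (fun x hx => fix0 x (hC hx)), Submodule.map_id]
  have mE : E.map χ = E' := map_of_equiv eE (fun x => by
    rw [a3 x (hEB x.2), a2 x (le_sup_right (a := U₀) (b := E) x.2), b1 x])
  have mR : R.map χ = R' := map_of_equiv eR (fun x => by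
    rw [a3 x (hRB x.2), b2 x])
  have mQ : Q.map χ = Q := map_of_equiv (LinearEquiv.refl F Q) (fun x => by
    rw [b3 x]; rfl)
  have mB : B.map χ = B := by
    conv_lhs => rw [← h4]
    rw [Submodule.map_sup, Submodule.map_sup, m0 _ le_rfl, mE, mR, h4']
  have mU : U.map χ = U₂ := by
    conv_lhs => rw [← h3]
    rw [Submodule.map_sup, m0 _ inf_le_right, mE, hC, h3']
  have hs : Function.Surjective χ := by
    rw [← LinearMap.range_eq_top, ← Submodule.map_top, ← hQ.sup_eq_top, Submodule.map_sup, mB, mQ]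
  have hi : Function.Injective χ := LinearMap.injective_iff_surjective.2 hs
  exact ⟨LinearEquiv.ofBijective χ ⟨hi, hs⟩, fix0, mU, mB⟩

lemma exists_mid [FiniteDimensional F V] (B U : Submodule F V) (h : U ≤ B) (d : ℕ)
    (h1 : finrank F U ≤ d) (h2 : d ≤ finrank F B) : ∃ W, U ≤ W ∧ W ≤ B ∧ finrank F W = d := by
  obtain ⟨e, rfl⟩ := Nat.exists_eq_add_of_le h1
  clear h1
  induction e with
  | zero => exact ⟨U, le_rfl, h, rfl⟩
  | succ e ih =>
    obtain ⟨W, hUW, hWB, hW⟩ := ih (by omega)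
    have hne : W ≠ B := by rintro rfl; omega
    obtain ⟨x, hxB, hxW⟩ := SetLike.exists_of_lt (lt_of_le_of_ne hWB hne)
    have hle : W ⊔ F ∙ x ≤ B := sup_le hWB (by simpa using hxB)
    refine ⟨W ⊔ F ∙ x, hUW.trans le_sup_left, hle, ?_⟩
    have hlt : W < W ⊔ F ∙ x := lt_of_le_of_ne le_sup_left (fun h => hxW (by
      rw [h]; exact le_sup_right (a := W) (Submodule.mem_span_singleton_self x)))
    have := Submodule.finrank_lt_finrank_of_lt hlt
    have := Submodule.finrank_add_le_finrank_add_finrank W (F ∙ x)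
    have := finrank_span_singleton (K := F) (v := x) (by rintro rfl; exact hxW (zero_mem W))
    omega

open Classical in
theorem kantor [Finite V] [FiniteDimensional F V] [Fintype (Submodule F V)] (A B : Submodule F V) (k l : ℕ)
    (hkl : k ≤ l) (hAB : finrank F A + k + l ≤ finrank F B) 
    (f : Submodule F V → ℚ)
    (hf : ∀ W, A ≤ W → W ≤ B → finrank F W = finrank F A + l →
      ∑ U with (A ≤ U ∧ U ≤ W ∧ finrank F U = finrank F A + k), f U = 0)
    (U₀ : Submodule F V) (hA0 : A ≤ U₀) (h0B : U₀ ≤ B) (h0 : finrank F U₀ = finrank F A + k) :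
    f U₀ = 0 := by
  have : Finite (V ≃ₗ[F] V) := DFunLike.finite _
  let S : Subgroup (V ≃ₗ[F] V) :=
    { carrier := {g | A.map (g : V →ₗ[F] V) = A ∧ B.map (g : V →ₗ[F] V) = B ∧
        U₀.map (g : V →ₗ[F] V) = U₀}
      one_mem' := ⟨Submodule.map_id _, Submodule.map_id _, Submodule.map_id _⟩
      mul_mem' := by
        rintro g h ⟨a, b, c⟩ ⟨a', b', c'⟩
        have e : ((g * h : V ≃ₗ[F] V) : V →ₗ[F] V) = (g : V →ₗ[F] V) ∘ₗ (h : V →ₗ[F] V) := rfl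
        refine ⟨?_, ?_, ?_⟩ <;> rw [e, Submodule.map_comp] <;> simp only [*]
      inv_mem' := by
        rintro g ⟨a, b, c⟩
        have e : ∀ W : Submodule F V, W.map (g : V →ₗ[F] V) = W →
          W.map ((g⁻¹ : V ≃ₗ[F] V) : V →ₗ[F] V) = W := by
          intro W hW
          have : ((g⁻¹ : V ≃ₗ[F] V) : V →ₗ[F] V) ∘ₗ (g : V →ₗ[F] V) = LinearMap.id := by
            ext x; exact g.symm_apply_apply x
          conv_lhs => rw [← hW]
          rw [← Submodule.map_comp, this, Submodule.map_id]
        exact ⟨e _ a, e _ b, e _ c⟩ }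
  have : Fintype S := Fintype.ofFinite _
  set f' : Submodule F V → ℚ := fun U => ∑ g : S, f (U.map ((g : V ≃ₗ[F] V) : V →ₗ[F] V)) with hf'
  have inv : ∀ h : S, ∀ U, f' (U.map ((h : V ≃ₗ[F] V) : V →ₗ[F] V)) = f' U := by
    intro h U
    refine Fintype.sum_equiv (Equiv.mulRight h) _ _ (fun g => ?_)
    rw [← Submodule.map_comp]; rfl
  have ker : ∀ W, A ≤ W → W ≤ B → finrank F W = finrank F A + l →
      ∑ U with (A ≤ U ∧ U ≤ W ∧ finrank F U = finrank F A + k), f' U = 0 := by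
    intro W hAW hWB hW
    rw [hf', Finset.sum_comm]
    refine Finset.sum_eq_zero (fun g _ => ?_)
    obtain ⟨g, ga, gb, gc⟩ := g
    have hle : ∀ X Y : Submodule F V, X.map (g : V →ₗ[F] V) ≤ Y.map (g : V →ₗ[F] V) ↔ X ≤ Y :=
      fun X Y => Submodule.map_le_map_iff_of_injective g.injective X Y
    have hfr : ∀ X : Submodule F V, finrank F (X.map (g : V →ₗ[F] V)) = finrank F X :=
      fun X => LinearEquiv.finrank_map_eq g X
    rw [← hf (W.map (g : V →ₗ[F] V)) (by rw [← ga, hle]; exact hAW) (by rw [← gb, hle]; exact hWB)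
      (by rw [hfr, hW])]
    refine Finset.sum_equiv (Submodule.orderIsoMapComap g).toEquiv ?_ ?_
    · intro U
      simp only [Finset.mem_filter, Finset.mem_univ, true_and]
      change _ ↔ A ≤ U.map (g : V →ₗ[F] V) ∧ U.map (g : V →ₗ[F] V) ≤ W.map (g : V →ₗ[F] V) ∧ 
        finrank F (U.map (g : V →ₗ[F] V)) = _
      rw [hle, hfr]
      conv_rhs => rw [← ga, hle, hfr]
    · intro U _; rfl
  have main : ∀ i : ℕ, ∀ U, A ≤ U → U ≤ B → finrank F U = finrank F A + k →
      finrank F (U ⊓ U₀ : Submodule F V) = i → f' U = 0 := by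
    intro i
    induction i using Nat.strong_induction_on with
    | _ i ih =>
    intro U hAU hUB hU hi
    obtain ⟨D', hD1, hD2⟩ := IsModularLattice.exists_disjoint_and_sup_eq (sup_le hUB h0B)
    have e1 := Submodule.finrank_sup_add_finrank_inf_eq (U ⊔ U₀) D'
    have e2 := Submodule.finrank_sup_add_finrank_inf_eq U U₀
    have e3 := Submodule.finrank_mono (le_inf hAU hA0)
    rw [hD2, hD1.eq_bot, finrank_bot] at e1
    obtain ⟨D, -, hDD, hD⟩ := exists_mid D' ⊥ bot_le (l - k) (by simp) (by omega)
    have hDU : Disjoint (U ⊔ U₀) D := hD1.mono_right hDD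
    have e4 := Submodule.finrank_sup_add_finrank_inf_eq U D
    rw [(hDU.mono_left le_sup_left).eq_bot, finrank_bot] at e4
    have hDB : D ≤ B := hDD.trans (hD2 ▸ le_sup_right)
    have hW0 : (U ⊔ D) ⊓ U₀ = U ⊓ U₀ := by
      apply le_antisymm
      · refine le_inf ?_ inf_le_right
        calc (U ⊔ D) ⊓ U₀ ≤ (U ⊔ D) ⊓ (U ⊔ U₀) := inf_le_inf_left _ le_sup_right
          _ = U ⊔ (D ⊓ (U ⊔ U₀)) := sup_inf_assoc_of_le _ le_sup_left
          _ = U := by rw [inf_comm, hDU.eq_bot, sup_bot_eq]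
      · exact inf_le_inf_right _ le_sup_left
    have hk := ker (U ⊔ D) (hAU.trans le_sup_left) (sup_le hUB hDB) (by omega)
    set T := Finset.univ.filter (fun X : Submodule F V =>
      A ≤ X ∧ X ≤ U ⊔ D ∧ finrank F X = finrank F A + k) with hT
    have hstep : ∀ X ∈ T, f' X = if X ⊓ U₀ = U ⊓ U₀ then f' U else 0 := by
      intro X hX
      simp only [hT, Finset.mem_filter, Finset.mem_univ, true_and] at hX
      obtain ⟨x1, x2, x3⟩ := hX
      have xB : X ≤ B := x2.trans (sup_le hUB hDB)
      split_ifs with h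
      · obtain ⟨g, g1, g2, g3⟩ := trans_aux B U₀ U X h0B hUB xB h.symm (by omega)
        have m0 : ∀ C ≤ U₀, C.map (g : V →ₗ[F] V) = C := fun C hC => by
          rw [map_eq_of_eqOn (h := LinearMap.id) (fun x hx => g1 x (hC hx)), Submodule.map_id]
        rw [← g2]
        exact inv ⟨g, m0 _ hA0, g3, m0 _ le_rfl⟩ U
      · have hlt : X ⊓ U₀ < U ⊓ U₀ :=
          lt_of_le_of_ne (hW0 ▸ inf_le_inf_right _ x2) h
        exact ih _ (hi ▸ Submodule.finrank_lt_finrank_of_lt hlt) X x1 xB x3 rfl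
    rw [Finset.sum_congr rfl hstep, ← Finset.sum_filter, Finset.sum_const, smul_eq_zero] at hk
    rcases hk with hk | hk
    · exfalso
      rw [Finset.card_eq_zero] at hk
      have : U ∈ T.filter (fun X => X ⊓ U₀ = U ⊓ U₀) := by
        simp [hT, hAU, hU]
      simp [hk] at this
    · exact hk
  have hfin := main _ U₀ hA0 h0B h0 rfl
  have : f' U₀ = Fintype.card S * f U₀ := by
    rw [hf']
    simp only
    rw [Finset.sum_congr rfl (fun g _ => by rw [g.2.2.2])]
    simp
  rw [this] at hfin
  rcases mul_eq_zero.1 hfin with h | h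
  · simp at h
  · exact h

open Classical in
theorem kantor_dual [Finite V] [Finite F] [FiniteDimensional F V] [Fintype (Submodule F V)]
    (A B : Submodule F V) (k l : ℕ)
    (hkl : k ≤ l) (hAB : finrank F A + k + l ≤ finrank F B) 
    (f : Submodule F V → ℚ)
    (hf : ∀ W, A ≤ W → W ≤ B → finrank F W + l = finrank F B →
      ∑ U with (W ≤ U ∧ U ≤ B ∧ finrank F U + k = finrank F B), f U = 0)
    (U₀ : Submodule F V) (hA0 : A ≤ U₀) (h0B : U₀ ≤ B) (h0 : finrank F U₀ + k = finrank F B) :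
    f U₀ = 0 := by
  let φ := Subspace.orderIsoFiniteDimensional (K := F) (V := V)
  let ψ : Submodule F V ≃ Submodule F (Dual F V) := φ.toEquiv.trans OrderDual.ofDual
  have : Finite (Dual F V) := DFunLike.finite _
  have : Fintype (Submodule F (Dual F V)) := Fintype.ofFinite _
  have hψ : ∀ X Y, ψ X ≤ ψ Y ↔ Y ≤ X := fun X Y => φ.le_iff_le (x := Y) (y := X)
  have hd : ∀ X : Submodule F V, finrank F X + finrank F (ψ X) = finrank F V := 
    fun X => Subspace.finrank_add_finrank_dualAnnihilator_eq X
  have dA := hd A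
  have dB := hd B
  have d0 := hd U₀
  have key := kantor (ψ B) (ψ A) k l hkl (by omega) (fun X => f (ψ.symm X)) ?_ (ψ U₀)
    ((hψ _ _).2 h0B) ((hψ _ _).2 hA0) (by omega)
  · simpa using key
  · intro W hBW hWA hW
    obtain ⟨W, rfl⟩ := ψ.surjective W
    have dW := hd W
    rw [hψ] at hBW hWA
    rw [← hf W hWA hBW (by omega)]
    refine Finset.sum_equiv ψ.symm ?_ (fun _ _ => rfl)
    intro X
    obtain ⟨X, rfl⟩ := ψ.surjective X
    have dX := hd X
    simp only [Finset.mem_filter, Finset.mem_univ, true_and, hψ, Equiv.symm_apply_apply]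
    constructor
    · rintro ⟨a, b, c⟩; exact ⟨b, a, by omega⟩
    · rintro ⟨a, b, c⟩; exact ⟨b, a, by omega⟩
end kantor

section orbits
open Classical in
theorem orbit_le {G X Y : Type*} [Group G] [MulAction G X] [MulAction G Y] [Fintype X] [Finite Y]
    (T : X → Y → Prop) (hT : ∀ (g : G) x y, T (g • x) (g • y) ↔ T x y)
    (hinj : ∀ f : X → ℚ, (∀ y, ∑ x with T x y, f x = 0) → ∀ x, f x = 0) :
    Nat.card (MulAction.orbitRel.Quotient G X) ≤ Nat.card (MulAction.orbitRel.Quotient G Y) := by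
  have : Finite (MulAction.orbitRel.Quotient G X) := Quotient.finite _
  have : Finite (MulAction.orbitRel.Quotient G Y) := Quotient.finite _
  have : Fintype (MulAction.orbitRel.Quotient G X) := Fintype.ofFinite _
  have : Fintype (MulAction.orbitRel.Quotient G Y) := Fintype.ofFinite _
  let p : X → MulAction.orbitRel.Quotient G X := Quotient.mk''
  have hp : ∀ (g : G) x, p (g • x) = p x := fun g x => 
    Quotient.sound' (MulAction.mem_orbit x g)
  have hsum : ∀ (u : MulAction.orbitRel.Quotient G X → ℚ) (g : G) (y : Y),
      ∑ x with T x (g • y), u (p x) = ∑ x with T x y, u (p x) := by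
    intro u g y
    refine (Finset.sum_equiv (MulAction.toPerm g) ?_ ?_).symm
    · intro x; simp [hT]
    · intro x _; simp [hp]
  let L : (MulAction.orbitRel.Quotient G X → ℚ) →ₗ[ℚ] (MulAction.orbitRel.Quotient G Y → ℚ) :=
    { toFun := fun u q => Quotient.liftOn' q (fun y => ∑ x with T x y, u (p x)) (by
        rintro y y' ⟨g, rfl⟩
        exact hsum u g y')
      map_add' := by
        intro u v; funext q
        induction q using Quotient.inductionOn'
        simp [Finset.sum_add_distrib]
      map_smul' := by
        intro c u; funext q
        induction q using Quotient.inductionOn'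
        simp [Finset.mul_sum] }
  have hL : Function.Injective L := by
    rw [injective_iff_map_eq_zero]
    intro u hu
    funext q
    induction q using Quotient.inductionOn' with | _ x =>
    refine hinj (fun x => u (p x)) (fun y => ?_) x
    exact congrFun hu (Quotient.mk'' y)
  have := LinearMap.finrank_le_finrank_of_injective hL
  simpa [Nat.card_eq_fintype_card] using this
end orbits

section flags
variable {F V G : Type*} [Field F] [AddCommGroup V] [Module F V] [Group G]

lemma isFlag_map {r : ℕ} {a : Fin r → ℕ} {f : Fin (r + 1) → Submodule F V}
    (h : IsFlagOfType a f) (g : V ≃ₗ[F] V) :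
    IsFlagOfType a (fun i => (f i).map (g : V →ₗ[F] V)) := by
  obtain ⟨h1, h2, h3, h4⟩ := h
  refine ⟨fun i j hij => Submodule.map_mono (h1 hij), ?_, ?_, fun i => ?_⟩
  · simp [h2]
  · simp [h3]
  · have := h4 i
    rw [LinearEquiv.finrank_map_eq g, LinearEquiv.finrank_map_eq g, this]

abbrev FlagT (F V : Type*) [Field F] [AddCommGroup V] [Module F V] {r : ℕ} (a : Fin r → ℕ) :=
  {f : Fin (r + 1) → Submodule F V // IsFlagOfType a f}

@[reducible] def flagAction (ρ : G →* (V ≃ₗ[F] V)) {r : ℕ} (a : Fin r → ℕ) :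
    MulAction G (FlagT F V a) where
  smul g f := ⟨fun i => (f.1 i).map ((ρ g) : V →ₗ[F] V), isFlag_map f.2 (ρ g)⟩
  one_smul f := by
    apply Subtype.ext; funext i
    change (f.1 i).map ((ρ 1 : V ≃ₗ[F] V) : V →ₗ[F] V) = f.1 i
    rw [map_one]; exact Submodule.map_id _
  mul_smul g h f := by
    apply Subtype.ext; funext i
    change (f.1 i).map ((ρ (g * h) : V ≃ₗ[F] V) : V →ₗ[F] V) =
      ((f.1 i).map ((ρ h : V ≃ₗ[F] V) : V →ₗ[F] V)).map ((ρ g : V ≃ₗ[F] V) : V →ₗ[F] V)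
    rw [map_mul, ← Submodule.map_comp]; rfl

lemma flagOrbitCount_eq (ρ : G →* (V ≃ₗ[F] V)) {r : ℕ} (a : Fin r → ℕ) :
    letI := flagAction ρ a
    flagOrbitCount F V G ρ a = Nat.card (MulAction.orbitRel.Quotient G (FlagT F V a)) := by
  letI := flagAction ρ a
  have ho : ∀ f₀ : FlagT F V a, MulAction.orbit G f₀ = {f : FlagT F V a | ∃ g : G,
        (f : Fin (r + 1) → Submodule F V) =
          fun i => Submodule.map ((ρ g) : V →ₗ[F] V) (f₀.1 i)} := by
    intro f₀; ext f
    constructor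
    · rintro ⟨g, rfl⟩; exact ⟨g, rfl⟩
    · rintro ⟨g, h⟩; exact ⟨g, Subtype.ext h.symm⟩
  symm
  refine Nat.card_eq_of_bijective
    (fun q : MulAction.orbitRel.Quotient G (FlagT F V a) => ⟨q.orbit, ?_⟩) ⟨?_, ?_⟩
  · induction q using Quotient.inductionOn' with | _ x =>
    exact ⟨x, by rw [← ho]; rfl⟩
  · intro q q' h
    exact MulAction.orbitRel.Quotient.orbit_injective (congrArg Subtype.val h)
  · rintro ⟨s, f₀, rfl⟩
    exact ⟨Quotient.mk'' f₀, Subtype.ext (ho f₀)⟩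

lemma isFlag_update {r : ℕ} {a b : Fin r → ℕ} {f : Fin (r + 1) → Submodule F V}
    (hf : IsFlagOfType a f) (i i' : Fin r) (hi : i'.val = i.val + 1)
    (hab : ∀ j, j ≠ i → j ≠ i' → a j = b j) (hs : a i + a i' = b i + b i')
    (U : Submodule F V) (h1 : f i.castSucc ≤ U) (h2 : U ≤ f i'.succ)
    (hU : finrank F U = finrank F (f i.castSucc) + b i) :
    IsFlagOfType b (Function.update f i.succ U) := by
  obtain ⟨m, b0, t, d⟩ := hf
  have e : i'.castSucc = i.succ := by ext; simp [hi]
  have n1 : i.castSucc ≠ i.succ := by simp [Fin.ext_iff]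
  have n2 : i'.succ ≠ i.succ := by simp [Fin.ext_iff, hi]
  have nj1 : ∀ j : Fin r, j ≠ i → j.succ ≠ i.succ := fun j hj h => hj (Fin.succ_injective _ h)
  have nj2 : ∀ j : Fin r, j ≠ i' → j.castSucc ≠ i.succ := fun j hj h => 
    hj (Fin.castSucc_injective _ (h.trans e.symm))
  refine ⟨?_, ?_, ?_, ?_⟩
  · rw [Fin.monotone_iff_le_succ]
    intro j
    by_cases hj : j = i
    · subst hj; rw [Function.update_of_ne n1, Function.update_self]; exact h1
    by_cases hj' : j = i'
    · subst hj'; rw [e, Function.update_self, Function.update_of_ne n2]; exact h2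
    · rw [Function.update_of_ne (nj1 j hj), Function.update_of_ne (nj2 j hj')]
      exact m (Fin.castSucc_lt_succ).le
  · rw [Function.update_of_ne (by simp [Fin.ext_iff]), b0]
  · rw [Function.update_of_ne (by simp only [ne_eq, Fin.ext_iff, Fin.val_last, Fin.val_succ]; omega), t]
  · intro j
    by_cases hj : j = i
    · subst hj; rw [Function.update_of_ne n1, Function.update_self]; exact hU
    by_cases hj' : j = i'
    · subst hj'
      rw [e, Function.update_self, Function.update_of_ne n2, d, hU, e, d]; omega
    · rw [Function.update_of_ne (nj1 j hj), Function.update_of_ne (nj2 j hj'), d, hab j hj hj']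

open Classical in
lemma sum_flag [Fintype (Submodule F V)] {r : ℕ} {a : Fin r → ℕ} [Fintype (FlagT F V a)]
    (f₀ : FlagT F V a) (i i' : Fin r)
    (hi : i'.val = i.val + 1) (rel : Submodule F V → Submodule F V → Prop)
    (f : FlagT F V a → ℚ) (W : Submodule F V) :
    ∑ x : FlagT F V a with ((∀ j, j ≠ i.succ → x.1 j = Function.update f₀.1 i.succ W j) ∧
        rel (x.1 i.succ) W), f x =
    ∑ U : Submodule F V with (f₀.1 i.castSucc ≤ U ∧ U ≤ f₀.1 i'.succ ∧ 
        finrank F U = finrank F (f₀.1 i.castSucc) + a i ∧ rel U W),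
      (if h : IsFlagOfType a (Function.update f₀.1 i.succ U) then f ⟨_, h⟩ else 0) := by
  have e : i'.castSucc = i.succ := by ext; simp [hi]
  have n1 : i.castSucc ≠ i.succ := by simp [Fin.ext_iff]
  have n2 : i'.succ ≠ i.succ := by simp [Fin.ext_iff, hi]
  have hx : ∀ x : FlagT F V a, (∀ j, j ≠ i.succ → x.1 j = Function.update f₀.1 i.succ W j) →
      Function.update f₀.1 i.succ (x.1 i.succ) = x.1 := by
    intro x h; funext j
    by_cases hj : j = i.succ
    · subst hj; simp
    · rw [Function.update_of_ne hj, h j hj, Function.update_of_ne hj]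
  refine Finset.sum_bij (fun x _ => x.1 i.succ) ?_ ?_ ?_ ?_
  · intro x hm
    simp only [Finset.mem_filter, Finset.mem_univ, true_and] at hm ⊢
    have q1 := hm.1 _ n1
    have q2 := hm.1 _ n2
    rw [Function.update_of_ne n1] at q1
    rw [Function.update_of_ne n2] at q2
    rw [← q1, ← q2]
    refine ⟨x.2.1 (Fin.castSucc_lt_succ).le, ?_, x.2.2.2.2 i, hm.2⟩
    rw [← e]; exact x.2.1 (Fin.castSucc_lt_succ).le
  · intro x hm y hm' h
    simp only [Finset.mem_filter, Finset.mem_univ, true_and] at hm hm'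
    apply Subtype.ext
    rw [← hx x hm.1, ← hx y hm'.1, h]
  · intro U hU
    simp only [Finset.mem_filter, Finset.mem_univ, true_and] at hU
    obtain ⟨u1, u2, u3, u4⟩ := hU
    refine ⟨⟨_, isFlag_update (b := a) f₀.2 i i' hi (fun _ _ _ => rfl) rfl U u1 u2 u3⟩, ?_, by simp⟩
    simp only [Finset.mem_filter, Finset.mem_univ, true_and, Function.update_self, u4, and_true]
    intro j hj
    rw [Function.update_of_ne hj, Function.update_of_ne hj]
  · intro x hm
    simp only [Finset.mem_filter, Finset.mem_univ, true_and] at hm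
    have h := hx x hm.1
    rw [dif_pos (by rw [h]; exact x.2)]
    congr 1
    exact Subtype.ext h.symm

theorem flag_step [Finite F] [FiniteDimensional F V] (ρ : G →* (V ≃ₗ[F] V)) {r : ℕ}
    (a b : Fin r → ℕ) (i i' : Fin r) (hi : i'.val = i.val + 1)
    (hab : ∀ j, j ≠ i → j ≠ i' → a j = b j) (hs : a i + a i' = b i + b i')
    (h : (a i ≤ b i ∧ b i ≤ a i') ∨ (b i ≤ a i ∧ a i' ≤ b i)) :
    flagOrbitCount F V G ρ a ≤ flagOrbitCount F V G ρ b := by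
  classical
  rw [flagOrbitCount_eq, flagOrbitCount_eq]
  letI := flagAction ρ a
  letI := flagAction ρ b
  have : Finite V := Module.finite_of_finite F
  have : Fintype (Submodule F V) := Fintype.ofFinite _
  have : Fintype (FlagT F V a) := Fintype.ofFinite _
  have e : i'.castSucc = i.succ := by ext; simp [hi]
  have hle : ∀ (g : V ≃ₗ[F] V) (X Y : Submodule F V), X.map (g : V →ₗ[F] V) ≤ Y.map (g : V →ₗ[F] V) ↔ X ≤ Y :=
      fun g X Y => Submodule.map_le_map_iff_of_injective g.injective X Y
  have heq : ∀ (g : V ≃ₗ[F] V) (X Y : Submodule F V), X.map (g : V →ₗ[F] V) = Y.map (g : V →ₗ[F] V) ↔ X = Y :=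
      fun g X Y => (Submodule.map_injective_of_injective g.injective).eq_iff
  have hval : ∀ (c : Fin r → ℕ) (g : G) (x : FlagT F V c) j, 
    ((flagAction ρ c).toSMul.smul g x).1 j = (x.1 j).map ((ρ g : V ≃ₗ[F] V) : V →ₗ[F] V) := fun _ _ _ _ => rfl
  rcases h with ⟨h1, h2⟩ | ⟨h1, h2⟩
  · refine orbit_le (fun x y => (∀ j, j ≠ i.succ → x.1 j = y.1 j) ∧ x.1 i.succ ≤ y.1 i.succ) ?_ ?_
    · intro g x y
      change ((∀ j, j ≠ i.succ → (x.1 j).map ((ρ g : V ≃ₗ[F] V) : V →ₗ[F] V) = (y.1 j).map ((ρ g : V ≃ₗ[F] V) : V →ₗ[F] V)) ∧ 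
        (x.1 i.succ).map ((ρ g : V ≃ₗ[F] V) : V →ₗ[F] V) ≤ (y.1 i.succ).map ((ρ g : V ≃ₗ[F] V) : V →ₗ[F] V)) ↔ _
      simp only [hle, heq]
    · intro f hf f₀
      have d1 := f₀.2.2.2.2 i
      have d2 := f₀.2.2.2.2 i'
      rw [e] at d2
      have key := kantor (f₀.1 i.castSucc) (f₀.1 i'.succ) (a i) (b i) h1 (by omega)
        (fun U => if h : IsFlagOfType a (Function.update f₀.1 i.succ U) then f ⟨_, h⟩ else 0)
        ?_ (f₀.1 i.succ) (f₀.2.1 (Fin.castSucc_lt_succ).le)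
        (by rw [← e]; exact f₀.2.1 (Fin.castSucc_lt_succ).le) d1
      · simpa [f₀.2] using key
      · intro W w1 w2 w3
        have := hf ⟨_, isFlag_update f₀.2 i i' hi hab hs W w1 w2 w3⟩
        simp only [Function.update_self] at this
        rw [sum_flag f₀ i i' hi (fun X Y => X ≤ Y)] at this
        refine Eq.trans ?_ this
        refine Finset.sum_congr ?_ (fun _ _ => rfl)
        ext U
        simp only [Finset.mem_filter, Finset.mem_univ, true_and]
        constructor
        · rintro ⟨x, y, z⟩; exact ⟨x, y.trans w2, z, y⟩
        · rintro ⟨x, y, z, w⟩; exact ⟨x, w, z⟩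
  · refine orbit_le (fun x y => (∀ j, j ≠ i.succ → x.1 j = y.1 j) ∧ y.1 i.succ ≤ x.1 i.succ) ?_ ?_
    · intro g x y
      change ((∀ j, j ≠ i.succ → (x.1 j).map ((ρ g : V ≃ₗ[F] V) : V →ₗ[F] V) = (y.1 j).map ((ρ g : V ≃ₗ[F] V) : V →ₗ[F] V)) ∧ 
        (y.1 i.succ).map ((ρ g : V ≃ₗ[F] V) : V →ₗ[F] V) ≤ (x.1 i.succ).map ((ρ g : V ≃ₗ[F] V) : V →ₗ[F] V)) ↔ _
      simp only [hle, heq]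
    · intro f hf f₀
      have d1 := f₀.2.2.2.2 i
      have d2 := f₀.2.2.2.2 i'
      rw [e] at d2
      have key := kantor_dual (f₀.1 i.castSucc) (f₀.1 i'.succ) (a i') (b i') (by omega) (by omega)
        (fun U => if h : IsFlagOfType a (Function.update f₀.1 i.succ U) then f ⟨_, h⟩ else 0)
        ?_ (f₀.1 i.succ) (f₀.2.1 (Fin.castSucc_lt_succ).le)
        (by rw [← e]; exact f₀.2.1 (Fin.castSucc_lt_succ).le) d2.symm
      · simpa [f₀.2] using key
      · intro W w1 w2 w3
        have := hf ⟨_, isFlag_update f₀.2 i i' hi hab hs W w1 w2 (by omega)⟩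
        simp only [Function.update_self] at this
        rw [sum_flag f₀ i i' hi (fun X Y => Y ≤ X)] at this
        refine Eq.trans ?_ this
        refine Finset.sum_congr ?_ (fun _ _ => rfl)
        ext U
        simp only [Finset.mem_filter, Finset.mem_univ, true_and]
        constructor
        · rintro ⟨x, y, z⟩; exact ⟨w1.trans x, y, by omega, x⟩
        · rintro ⟨x, y, z, w⟩; exact ⟨w, y, by omega⟩
end flags

section comb

def Phi {r : ℕ} (a : Fin r → ℕ) (t : ℕ) : ℕ := ∑ i, (a i - t)

def alph {r : ℕ} (a : Fin r → ℕ) (t : ℕ) : ℕ := (Finset.univ.filter (fun i => t < a i)).card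

def cnt {r : ℕ} (a : Fin r → ℕ) (t : ℕ) : ℕ := (Finset.univ.filter (fun i => a i = t)).card

lemma Phi_succ {r : ℕ} (a : Fin r → ℕ) (t : ℕ) : Phi a t = Phi a (t + 1) + alph a t := by
  unfold Phi alph
  rw [Finset.card_filter, ← Finset.sum_add_distrib]
  refine Finset.sum_congr rfl (fun i _ => ?_)
  split_ifs <;> omega

lemma alph_succ {r : ℕ} (a : Fin r → ℕ) (t : ℕ) : alph a t = alph a (t + 1) + cnt a (t + 1) := by
  unfold alph cnt
  simp only [Finset.card_filter]
  rw [← Finset.sum_add_distrib]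
  refine Finset.sum_congr rfl (fun i _ => ?_)
  split_ifs <;> omega

lemma alph_zero {r : ℕ} (a : Fin r → ℕ) : r = alph a 0 + cnt a 0 := by
  unfold alph cnt
  simp only [Finset.card_filter]
  rw [← Finset.sum_add_distrib]
  conv_lhs => rw [← Fintype.card_fin r, ← Finset.card_univ, Finset.card_eq_sum_ones]
  refine Finset.sum_congr rfl (fun i _ => ?_)
  split_ifs <;> omega

lemma exists_of_cnt {r : ℕ} {a : Fin r → ℕ} {t : ℕ} (h : 0 < cnt a t) : ∃ i, a i = t := by
  obtain ⟨i, hi⟩ := Finset.card_pos.1 h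
  exact ⟨i, by simpa using hi⟩

lemma perm_of_Phi {r : ℕ} (a b : Fin r → ℕ) (h : ∀ t, Phi a t = Phi b t) :
    ∃ σ : Equiv.Perm (Fin r), a = b ∘ σ := by
  have h1 : ∀ t, alph a t = alph b t := fun t => by
    have := Phi_succ a t; have := Phi_succ b t; have := h t; have := h (t + 1); omega
  have h2 : ∀ t, cnt a t = cnt b t := fun t => by
    cases t with
    | zero => have := alph_zero a; have := alph_zero b; have := h1 0; omega
    | succ t => 
      have := alph_succ a t; have := alph_succ b t; have := h1 t; have := h1 (t + 1); omega
  have e : ∀ t, Nonempty ({i // a i = t} ≃ {i // b i = t}) := fun t => by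
    refine ⟨Fintype.equivOfCardEq ?_⟩
    rw [Fintype.card_subtype, Fintype.card_subtype]; exact h2 t
  let e' := fun t => (e t).some
  refine ⟨(Equiv.sigmaFiberEquiv a).symm.trans
    ((Equiv.sigmaCongrRight e').trans (Equiv.sigmaFiberEquiv b)), ?_⟩
  funext i
  exact ((e' (a i)) ⟨i, rfl⟩).2.symm

lemma sum_move {r : ℕ} (a : Fin r → ℕ) (g : ℕ → ℕ) (i j : Fin r) (hij : i ≠ j) (x y : ℕ) :
    ∑ k, g (Function.update (Function.update a i x) j y k) + g (a i) + g (a j) =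
      ∑ k, g (a k) + g x + g y := by
  have hj : j ∈ Finset.univ.erase i := by simp [hij.symm]
  rw [← Finset.add_sum_erase _ _ (Finset.mem_univ i), ← Finset.add_sum_erase _ _ hj,
    ← Finset.add_sum_erase (f := fun k => g (a k)) _ (Finset.mem_univ i), 
    ← Finset.add_sum_erase (f := fun k => g (a k)) _ hj]
  have : ∑ k ∈ (Finset.univ.erase i).erase j, g (Function.update (Function.update a i x) j y k) =
      ∑ k ∈ (Finset.univ.erase i).erase j, g (a k) := by
    refine Finset.sum_congr rfl (fun k hk => ?_)
    simp only [Finset.mem_erase] at hk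
    rw [Function.update_of_ne hk.1, Function.update_of_ne hk.2.1]
  rw [this]
  simp only [Function.update_self, Function.update_of_ne hij]
  omega

def StepMono {r : ℕ} (N : (Fin r → ℕ) → ℕ) : Prop :=
  ∀ (a b : Fin r → ℕ) (i i' : Fin r), i'.val = i.val + 1 →
    (∀ j, j ≠ i → j ≠ i' → a j = b j) → a i + a i' = b i + b i' →
    ((a i ≤ b i ∧ b i ≤ a i') ∨ (b i ≤ a i ∧ a i' ≤ b i)) → N a ≤ N b

lemma perm_le {r : ℕ} {N : (Fin r → ℕ) → ℕ} (hN : StepMono N) (σ : Equiv.Perm (Fin r)) :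
    ∀ a, N a ≤ N (a ∘ σ) := by
  cases r with
  | zero => intro a; rw [Subsingleton.elim (a ∘ σ) a]
  | succ n =>
    have hσ : σ ∈ Submonoid.closure (Set.range fun i : Fin n => Equiv.swap i.castSucc i.succ) := by
      rw [Equiv.Perm.mclosure_swap_castSucc_succ]; trivial
    induction hσ using Submonoid.closure_induction with
    | mem τ hτ =>
      obtain ⟨i, rfl⟩ := hτ
      intro a
      refine hN a _ i.castSucc i.succ (by simp) ?_ ?_ ?_
      · intro j h1 h2
        simp [Equiv.swap_apply_of_ne_of_ne h1 h2]
      · simp [add_comm]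
      · simp only [Function.comp_apply, Equiv.swap_apply_left]
        have := le_total (a i.castSucc) (a i.succ)
        simpa using this
    | one => intro a; exact le_rfl
    | mul x y _ _ hx hy =>
      intro a
      exact (hx a).trans (hy (a ∘ x))

lemma move_le {r : ℕ} {N : (Fin r → ℕ) → ℕ} (hN : StepMono N) (a : Fin r → ℕ) (i j : Fin r)
    (hij : i ≠ j) (p q : ℕ) (hi : a i = p + 1) (hj : a j = q) (hqp : q < p) :
    N a ≤ N (Function.update (Function.update a i p) j (q + 1)) := by
  set b := Function.update (Function.update a i p) j (q + 1) with hb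
  have hr : 2 ≤ r := by
    have : i.val ≠ j.val := fun h => hij (Fin.ext h)
    omega
  let z : Fin r := ⟨0, by omega⟩
  let o : Fin r := ⟨1, by omega⟩
  have hzo : z ≠ o := by simp [z, o]
  let σ : Equiv.Perm (Fin r) := Equiv.swap z i * Equiv.swap o (Equiv.swap z i j)
  have hz : σ z = i := by
    have : z ≠ Equiv.swap z i j := by
      intro h
      have := congrArg (Equiv.swap z i) h
      simp at this; exact hij this
    simp [σ, Equiv.swap_apply_of_ne_of_ne hzo this]
  have ho : σ o = j := by simp [σ]
  have hbi : b i = p := by rw [hb, Function.update_of_ne hij, Function.update_self]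
  have hbj : b j = q + 1 := by rw [hb, Function.update_self]
  have h1 := perm_le hN σ a
  have h2 : N (a ∘ σ) ≤ N (b ∘ σ) := by
    refine hN _ _ z o rfl ?_ ?_ ?_
    · intro k h1 h2
      have n1 : σ k ≠ i := fun h => h1 (σ.injective (h.trans hz.symm))
      have n2 : σ k ≠ j := fun h => h2 (σ.injective (h.trans ho.symm))
      simp only [Function.comp_apply]
      rw [hb, Function.update_of_ne n2, Function.update_of_ne n1]
    · simp only [Function.comp_apply, hz, ho, hi, hj, hbi, hbj]; omega
    · simp only [Function.comp_apply, hz, ho, hi, hj, hbi]; omega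
  have h3 := perm_le hN σ⁻¹ (b ∘ σ)
  have h4 : (b ∘ σ) ∘ (σ⁻¹ : Equiv.Perm (Fin r)) = b := by
    funext k; simp
  rw [h4] at h3
  exact h1.trans (h2.trans h3)

lemma Phi_le_of_dom {r : ℕ} (a b : Fin r → ℕ)
    (hdom : ∀ i : Fin r, ∑ j ∈ Finset.Iic i, sortDesc b j ≤ ∑ j ∈ Finset.Iic i, sortDesc a j) (t : ℕ) :
    Phi b t ≤ Phi a t := by
  have hs : ∀ c : Fin r → ℕ, Phi (sortDesc c) t = Phi c t := fun c => by
    unfold Phi sortDesc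
    exact Equiv.sum_comp (Fin.revPerm.trans (Tuple.sort c)) (fun i => c i - t)
  have hanti : Antitone (sortDesc b) := by
    intro x y hxy
    exact Tuple.monotone_sort b (Fin.rev_le_rev.2 hxy)
  rw [← hs a, ← hs b]
  generalize sortDesc a = A at *
  generalize sortDesc b = B at *
  unfold Phi
  by_cases hne : (Finset.univ.filter (fun i => t < B i)).Nonempty
  · obtain ⟨m, hm, hmax⟩ := Finset.exists_max_image _ id hne
    simp only [Finset.mem_filter, Finset.mem_univ, true_and, id] at hm hmax
    have hB : ∀ j, j ∈ Finset.Iic m ↔ t < B j := fun j => by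
      rw [Finset.mem_Iic]
      exact ⟨fun h => hm.trans_le (hanti h), hmax j⟩
    have e1 : ∑ j, (B j - t) = ∑ j ∈ Finset.Iic m, (B j - t) := by
      symm
      refine Finset.sum_subset (Finset.subset_univ _) (fun j _ hj => ?_)
      rw [hB] at hj; omega
    have e2 : ∑ j ∈ Finset.Iic m, (B j - t) + ∑ j ∈ Finset.Iic m, t = ∑ j ∈ Finset.Iic m, B j := by
      rw [← Finset.sum_add_distrib]
      refine Finset.sum_congr rfl (fun j hj => ?_)
      rw [hB] at hj; omega
    have e3 : ∑ j ∈ Finset.Iic m, A j ≤ ∑ j ∈ Finset.Iic m, (A j - t) + ∑ j ∈ Finset.Iic m, t := by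
      rw [← Finset.sum_add_distrib]
      exact Finset.sum_le_sum (fun j hj => by omega)
    have e4 : ∑ j ∈ Finset.Iic m, (A j - t) ≤ ∑ j, (A j - t) :=
      Finset.sum_le_sum_of_subset (Finset.subset_univ _)
    have := hdom m
    omega
  · rw [Finset.not_nonempty_iff_eq_empty] at hne
    have : ∑ j, (B j - t) = 0 := Finset.sum_eq_zero (fun j _ => by
      have : j ∉ Finset.univ.filter (fun i => t < B i) := by rw [hne]; simp
      simp at this; omega)
    omega

theorem main_comb {r : ℕ} {N : (Fin r → ℕ) → ℕ} (hN : StepMono N) (b : Fin r → ℕ) :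
    ∀ (M : ℕ) (a : Fin r → ℕ), ∑ i, a i ^ 2 = M → Phi a 0 = Phi b 0 →
      (∀ t, Phi b t ≤ Phi a t) → N a ≤ N b := by
  intro M
  induction M using Nat.strong_induction_on with
  | _ M ih =>
  intro a hM h0 hle
  by_cases hall : ∀ t, Phi a t = Phi b t
  · obtain ⟨σ, hσ⟩ := perm_of_Phi b a (fun t => (hall t).symm)
    rw [hσ]; exact perm_le hN σ a
  push Not at hall
  obtain ⟨t₀, ht₀⟩ := hall
  have hbig : ∀ t, Phi a 0 < t → Phi a t = 0 := fun t ht => by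
    refine Finset.sum_eq_zero (fun i _ => ?_)
    have : a i - 0 ≤ Phi a 0 := Finset.single_le_sum (f := fun i => a i - 0) (fun _ _ => Nat.zero_le _) (Finset.mem_univ i)
    omega
  classical
  obtain ⟨p, hp, hpmax⟩ : ∃ p, Phi b p < Phi a p ∧ ∀ t, p < t → Phi a t = Phi b t := by
    have ht : Phi b t₀ < Phi a t₀ := lt_of_le_of_ne (hle t₀) (Ne.symm ht₀)
    have ht0 : t₀ ≤ Phi a 0 := by
      by_contra h
      have := hbig t₀ (by omega); omega
    refine ⟨Nat.findGreatest (fun t => Phi b t < Phi a t) (Phi a 0),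
      Nat.findGreatest_spec (P := fun t => Phi b t < Phi a t) ht0 ht, fun t h => ?_⟩
    have := hle t
    by_cases h' : t ≤ Phi a 0
    · have := Nat.findGreatest_is_greatest h h'; omega
    · have := hbig t (by omega); omega
  obtain ⟨q, hqp, hq, hqmax⟩ : ∃ q, q < p ∧ Phi a q = Phi b q ∧ 
      ∀ t, q < t → t ≤ p → Phi b t < Phi a t := by
    have hs := Nat.findGreatest_spec (P := fun t => Phi a t = Phi b t) (Nat.zero_le p) h0
    refine ⟨Nat.findGreatest (fun t => Phi a t = Phi b t) p, ?_, hs, fun t h h' => ?_⟩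
    · refine lt_of_le_of_ne (Nat.findGreatest_le p) (fun h => ?_)
      rw [h] at hs; omega
    · have := Nat.findGreatest_is_greatest h h'
      have := hle t; omega
  obtain ⟨i, hi⟩ : ∃ i, a i = p + 1 := by
    apply exists_of_cnt
    have := Phi_succ a p; have := Phi_succ b p
    have := Phi_succ a (p + 1); have := Phi_succ b (p + 1)
    have := alph_succ a p; have := alph_succ b p
    have := hpmax (p + 1) (by omega); have := hpmax (p + 1 + 1) (by omega)
    omega
  obtain ⟨j, hj⟩ : ∃ j, a j = q := by
    apply exists_of_cnt
    have := Phi_succ a q; have := Phi_succ b q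
    have := hqmax (q + 1) (by omega) (by omega)
    rcases q with _ | s
    · have := alph_zero a; have := alph_zero b; omega
    · have := Phi_succ a s; have := Phi_succ b s
      have := alph_succ a s; have := alph_succ b s
      have := hle s
      omega
  have hij : i ≠ j := by rintro rfl; omega
  refine (move_le hN a i j hij p q hi hj hqp).trans ?_
  have hPhi : ∀ t, Phi (Function.update (Function.update a i p) j (q + 1)) t + (p + 1 - t) + (q - t)
      = Phi a t + (p - t) + (q + 1 - t) := fun t => by
    have := sum_move a (fun x => x - t) i j hij p (q + 1)
    rw [hi, hj] at this; exact this
  have hsq := sum_move a (fun x => x ^ 2) i j hij p (q + 1)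
  rw [hi, hj] at hsq
  refine ih _ ?_ _ rfl ?_ ?_
  · nlinarith
  · have := hPhi 0; omega
  · intro t
    have := hPhi t
    have := hle t
    by_cases h : q < t ∧ t ≤ p
    · have := hqmax t h.1 h.2; omega
    · omega
end comb

theorem stmt9 {F V G : Type*} [Field F] [Fintype F] [AddCommGroup V] [Module F V]
    [FiniteDimensional F V] [Group G] (ρ : G →* (V ≃ₗ[F] V))
    (n r : ℕ) (hn : Module.finrank F V = n) (a b : Fin r → ℕ)
    (ha : ∑ t, a t = n) (hb : ∑ t, b t = n)
    (hdom : ∀ i : Fin r, ∑ j ∈ Finset.Iic i, sortDesc b j ≤ ∑ j ∈ Finset.Iic i, sortDesc a j) :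
    flagOrbitCount F V G ρ a ≤ flagOrbitCount F V G ρ b := by
  refine main_comb (N := fun c => flagOrbitCount F V G ρ c) ?_ b _ a rfl ?_ (Phi_le_of_dom a b hdom)
  · intro a b i i' hi hab hs h
    exact flag_step ρ a b i i' hi hab hs h
  · simp [Phi, ha, hb]
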